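/- Let R = [r] × [s], let x ∈ ℝ_{>0}^R, let y = φ⁻¹(x), and fix 1 ≤ i ≤ r. Then the entries of the generalized Stanley–Thomas word ST_i(x) are given explicitly by: ρ^{−k}(y)_{is} = w^{(1)}_{[k+1,k+i] × [1,s]}(x) for 0 ≤ k ≤ r − i, and ρ^{−k}(y)_{is} = ω_{k+i−r+1, k+1}(x) for r − i < k ≤ r + s − 1. -/

import Mathlib

namespace Paper

/-- Membership in the rectangle poset `R = [1,r] × [1,s]` (coordinates in `ℤ`). -/
def inR (r s : ℕ) (p : ℤ × ℤ) : Prop :=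
  1 ≤ p.1 ∧ p.1 ≤ (r : ℤ) ∧ 1 ≤ p.2 ∧ p.2 ≤ (s : ℤ)

instance (r s : ℕ) : DecidablePred (inR r s) := fun _ => by unfold inR; infer_instance

/-- The cover relation in the product of two chains. -/
def CoverStep (p q : ℤ × ℤ) : Prop :=
  (q.1 = p.1 + 1 ∧ q.2 = p.2) ∨ (q.1 = p.1 ∧ q.2 = p.2 + 1)

/-- Upper covers of `p` inside the rectangle. -/
def upSet (r s : ℕ) (p : ℤ × ℤ) : Finset (ℤ × ℤ) :=
  ({(p.1 + 1, p.2), (p.1, p.2 + 1)} : Finset (ℤ × ℤ)).filter (inR r s)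

/-- Lower covers of `p` inside the rectangle. -/
def downSet (r s : ℕ) (p : ℤ × ℤ) : Finset (ℤ × ℤ) :=
  ({(p.1 - 1, p.2), (p.1, p.2 - 1)} : Finset (ℤ × ℤ)).filter (inR r s)

/-- Sum of the labels of the lower covers of `p` (empty sum = 1). -/
noncomputable def dsum (r s : ℕ) (x : ℤ × ℤ → ℝ) (p : ℤ × ℤ) : ℝ :=
  if (downSet r s p).Nonempty then ∑ q ∈ downSet r s p, x q else 1

/-- Parallel sum of the labels of the upper covers of `p` (empty parallel sum = 1). -/
noncomputable def usum (r s : ℕ) (x : ℤ × ℤ → ℝ) (p : ℤ × ℤ) : ℝ :=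
  if (upSet r s p).Nonempty then (∑ q ∈ upSet r s p, (x q)⁻¹)⁻¹ else 1

/-- The birational toggle at `p`. -/
noncomputable def toggle (r s : ℕ) (p : ℤ × ℤ) (x : ℤ × ℤ → ℝ) : ℤ × ℤ → ℝ :=
  fun q => if q = p then usum r s x p * dsum r s x p / x p else x q

/-- The elements of `[1,a] × [1,b]` listed from top to bottom
(descending lexicographic order, the reverse of a linear extension). -/
def rectList (a b : ℕ) : List (ℤ × ℤ) :=
  (List.range a).reverse.flatMap fun i =>
    (List.range b).reverse.map fun j => ((i : ℤ) + 1, (j : ℤ) + 1)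

/-- Birational rowmotion on the rectangle: toggles from top to bottom. -/
noncomputable def rho (r s : ℕ) (x : ℤ × ℤ → ℝ) : ℤ × ℤ → ℝ :=
  (rectList r s).foldl (fun y p => toggle r s p y) x

/-- Inverse birational rowmotion: toggles from bottom to top. -/
noncomputable def rhoInv (r s : ℕ) (x : ℤ × ℤ → ℝ) : ℤ × ℤ → ℝ :=
  (rectList r s).reverse.foldl (fun y p => toggle r s p y) x

/-- Integer powers of birational rowmotion. -/
noncomputable def rhoPow (r s : ℕ) (k : ℤ) (x : ℤ × ℤ → ℝ) : ℤ × ℤ → ℝ :=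
  if 0 ≤ k then (rho r s)^[k.toNat] x else (rhoInv r s)^[(-k).toNat] x

/-- Saturated chains from `a` to `b`, as lists of successive cover steps. -/
def ChainList (a b : ℤ × ℤ) : Type :=
  {l : List (ℤ × ℤ) // l.Chain' CoverStep ∧ l.head? = some a ∧ l.getLast? = some b}

/-- The inverse birational transfer map on the rectangle: `φ⁻¹(x)_p` is the total weight
of all saturated chains from the minimal element `(1,1)` to `p`. -/
noncomputable def phiInv (x : ℤ × ℤ → ℝ) : ℤ × ℤ → ℝ :=
  fun p => ∑ᶠ c : ChainList (1, 1) p, (c.1.map x).prod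

/-- The birational transfer map `φ(x)_p = x_p / ∑_{q ⋖ p} x_q`. -/
noncomputable def phi (r s : ℕ) (x : ℤ × ℤ → ℝ) : ℤ × ℤ → ℝ :=
  fun p => x p / dsum r s x p

/-- A collection of `k` pairwise vertex-disjoint lattice paths in the interval
`[i₁,i₂] × [j₁,j₂]`, from `(i₁,j₁),…,(i₁,j₁+k-1)` to `(i₂,j₂-k+1),…,(i₂,j₂)`. -/
structure RSys (i₁ i₂ j₁ j₂ : ℤ) (k : ℕ) where
  path : Fin k → List (ℤ × ℤ)
  chain : ∀ t, (path t).Chain' CoverStep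
  mem : ∀ t, ∀ v ∈ path t, i₁ ≤ v.1 ∧ v.1 ≤ i₂ ∧ j₁ ≤ v.2 ∧ v.2 ≤ j₂
  first : ∀ t : Fin k, (path t).head? = some (i₁, j₁ + ((t : ℕ) : ℤ))
  final : ∀ t : Fin k, (path t).getLast? = some (i₂, j₂ - k + 1 + ((t : ℕ) : ℤ))
  disjoint : ∀ t t' : Fin k, t ≠ t' → ∀ v ∈ path t, v ∉ path t'

/-- The weight of a collection of paths: the product of labels of all its elements. -/
noncomputable def RSysWeight (x : ℤ × ℤ → ℝ) {i₁ i₂ j₁ j₂ : ℤ} {k : ℕ}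
    (L : RSys i₁ i₂ j₁ j₂ k) : ℝ :=
  ∏ t : Fin k, ((L.path t).map x).prod

/-- `w_I^{(k)}(x)`: total weight of all collections of `k` nonintersecting paths in the
interval `I = [i₁,i₂] × [j₁,j₂]` (with `w_I^{(0)} = 1`). -/
noncomputable def w (i₁ i₂ j₁ j₂ : ℤ) (k : ℤ) (x : ℤ × ℤ → ℝ) : ℝ :=
  if k ≤ 0 then 1 else ∑ᶠ L : RSys i₁ i₂ j₁ j₂ k.toNat, RSysWeight x L

/-- `w_I(x)`: the product of all labels in the interval `I = [i₁,i₂] × [j₁,j₂]`. -/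
noncomputable def wProd (i₁ i₂ j₁ j₂ : ℤ) (x : ℤ × ℤ → ℝ) : ℝ :=
  ∏ p ∈ Finset.Icc i₁ i₂ ×ˢ Finset.Icc j₁ j₂, x p

/-- The directed edges of the graph `𝒢_R` on vertex set `[1,r+1] × [1,s]`:
`(i,j) → (i+1,j)` for `(i,j) ∈ R`, and `(i,j) → (i+1,j-1)` when valid. -/
def GEdge (r s : ℕ) (p q : ℤ × ℤ) : Prop :=
  1 ≤ p.1 ∧ p.1 ≤ (r : ℤ) ∧ 1 ≤ p.2 ∧ p.2 ≤ (s : ℤ) ∧ q.1 = p.1 + 1 ∧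
    (q.2 = p.2 ∨ (q.2 = p.2 - 1 ∧ 2 ≤ p.2))

/-- The weight of an edge of `𝒢_R`: `x_p⁻¹` for vertical edges, `1` for diagonal ones. -/
noncomputable def edgeWt (x : ℤ × ℤ → ℝ) (p q : ℤ × ℤ) : ℝ :=
  if q.2 = p.2 then (x p)⁻¹ else 1

/-- The weight of a directed path in `𝒢_R`, given as its list of vertices. -/
noncomputable def listWt (x : ℤ × ℤ → ℝ) (l : List (ℤ × ℤ)) : ℝ :=
  ((l.zip l.tail).map fun e => edgeWt x e.1 e.2).prod

/-- The boundary vertex `P_t` of `𝒢_R`: `P_j = (1,j)` for `1 ≤ j ≤ s`, `P_{s+i} = (i+1,s)`. -/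
def Pvert (s : ℕ) (t : ℤ) : ℤ × ℤ := if t ≤ (s : ℤ) then (1, t) else (t - s + 1, (s : ℤ))

/-- The boundary vertex `Q_t` of `𝒢_R`: `Q_i = (i,1)` for `1 ≤ i ≤ r`, `Q_{r+j} = (r+1,j)`. -/
def Qvert (r : ℕ) (t : ℤ) : ℤ × ℤ := if t ≤ (r : ℤ) then (t, 1) else ((r : ℤ) + 1, t - r)

/-- A collection of `k` pairwise vertex-disjoint directed paths in `𝒢_R` from
`{P_i, …, P_{i+k-1}}` to `{Q_j, …, Q_{j+k-1}}`. -/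
structure GSys (r s : ℕ) (i j : ℤ) (k : ℕ) where
  perm : Equiv.Perm (Fin k)
  path : Fin k → List (ℤ × ℤ)
  chain : ∀ t, (path t).Chain' (GEdge r s)
  first : ∀ t : Fin k, (path t).head? = some (Pvert s (i + ((t : ℕ) : ℤ)))
  final : ∀ t : Fin k, (path t).getLast? = some (Qvert r (j + (((perm t) : ℕ) : ℤ)))
  disjoint : ∀ t t' : Fin k, t ≠ t' → ∀ v ∈ path t, v ∉ path t'

/-- The weight of a collection of paths in `𝒢_R`: the product of the weights of all
edges used. -/
noncomputable def GSysWeight (x : ℤ × ℤ → ℝ) {r s : ℕ} {i j : ℤ} {k : ℕ}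
    (L : GSys r s i j k) : ℝ :=
  ∏ t : Fin k, listWt x (L.path t)

/-- `W_{ij}^{(k)}(x)`: total weight of all collections of `k` nonintersecting paths in
`𝒢_R` from `{P_i,…,P_{i+k-1}}` to `{Q_j,…,Q_{j+k-1}}`; `W_{ij}^{(0)} = 1`, and `0` when an
out-of-range index occurs. -/
noncomputable def W (r s : ℕ) (x : ℤ × ℤ → ℝ) (i j k : ℤ) : ℝ :=
  if k < 0 then 0
  else if k = 0 then 1
  else if 1 ≤ i ∧ 1 ≤ j ∧ i + k - 1 ≤ (r : ℤ) + s ∧ j + k - 1 ≤ (r : ℤ) + s then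
    ∑ᶠ L : GSys r s i j k.toNat, GSysWeight x L
  else 0


/-- Index data for `ω_{ab}`: a sequence `(i_t, j_t) ∈ R` for `a ≤ t ≤ b` with
`i_t + j_t = t` and `i_a < i_{a+1} < ⋯ < i_b` (encoded by `g t = i_t`, normalized to `0`
outside `[a,b]`). -/
def OmegaIdx (r s : ℕ) (a b : ℤ) : Type :=
  {g : ℤ → ℤ // (∀ t, a ≤ t → t ≤ b → inR r s (g t, t - g t)) ∧
    (∀ t t', a ≤ t → t < t' → t' ≤ b → g t < g t') ∧
    (∀ t, t < a ∨ b < t → g t = 0)}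

/-- `ω_{ab}(x) = ∑ (x_{i_a j_a} ⋯ x_{i_b j_b})⁻¹`, summed over all sequences of elements
of `R` at ranks `a, …, b` traveling northwest. -/
noncomputable def omega (r s : ℕ) (x : ℤ × ℤ → ℝ) (a b : ℤ) : ℝ :=
  ∑ᶠ g : OmegaIdx r s a b, (∏ t ∈ Finset.Icc a b, x (g.1 t, t - g.1 t))⁻¹

/-- The saturated chains from `a` to `b`, as a set of lists. -/
def chainSet (a b : ℤ × ℤ) : Set (List (ℤ × ℤ)) :=
  {l | l.IsChain CoverStep ∧ l.head? = some a ∧ l.getLast? = some b}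

/-- The total weight of all saturated chains from `a` to `b`. -/
noncomputable def pathSum (x : ℤ × ℤ → ℝ) (a b : ℤ × ℤ) : ℝ :=
  ∑ᶠ l ∈ chainSet a b, (l.map x).prod

theorem mem_chainSet_concat {a b : ℤ × ℤ} {l : List (ℤ × ℤ)} :
    l ++ [b] ∈ chainSet a b ↔
      (l = [] ∧ a = b) ∨ l ∈ chainSet a (b.1 - 1, b.2) ∨ l ∈ chainSet a (b.1, b.2 - 1) := by
  rcases List.eq_nil_or_concat l with rfl | ⟨l', c, rfl⟩
  · simp [chainSet, eq_comm]
  · have hcov : CoverStep c b ↔ c = (b.1 - 1, b.2) ∨ c = (b.1, b.2 - 1) := by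
      simp only [CoverStep, Prod.ext_iff]
      constructor <;> rintro (h | h) <;> [left; right; left; right] <;> omega
    have hhead : (l' ++ [c] ++ [b]).head? = (l' ++ [c]).head? := by cases l' <;> simp
    simp only [chainSet, Set.mem_ofPred_eq, hhead, List.isChain_append (l₂ := [b]), List.concat_eq_append]
    simp only [List.isChain_singleton, List.getLast?_append_of_ne_nil, ne_eq, List.cons_ne_nil,
      not_false_eq_true, List.getLast?_singleton, List.head?_cons, Option.mem_def,
      Option.some.injEq, true_and, forall_eq', hcov, List.append_eq_nil_iff, and_false, false_and,
      false_or, and_true]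
    tauto

theorem exists_eq_concat_of_mem_chainSet {a b : ℤ × ℤ} {l : List (ℤ × ℤ)} (h : l ∈ chainSet a b) :
    ∃ l', l = l' ++ [b] := by
  rcases List.eq_nil_or_concat l with rfl | ⟨l', c, rfl⟩
  · simp [chainSet] at h
  · refine ⟨l', ?_⟩
    have := h.2.2
    simp_all

theorem chainSet_eq_empty {a b : ℤ × ℤ} (h : ¬ (a.1 ≤ b.1 ∧ a.2 ≤ b.2)) : chainSet a b = ∅ := by
  rw [Set.eq_empty_iff_forall_notMem]
  intro l
  induction l using List.reverseRecOn generalizing b with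
  | nil => simp [chainSet]
  | append_singleton l c ih =>
    intro hl
    obtain ⟨l', hl'⟩ := exists_eq_concat_of_mem_chainSet hl
    obtain ⟨rfl, rfl⟩ : l = l' ∧ c = b := by simpa using hl'
    rcases mem_chainSet_concat.1 hl with ⟨-, rfl⟩ | h' | h'
    · exact h ⟨le_rfl, le_rfl⟩
    · exact ih (by simp only; omega) h'
    · exact ih (by simp only; omega) h'

theorem chainSet_self (a : ℤ × ℤ) : chainSet a a = {[a]} := by
  ext l
  rw [Set.mem_singleton_iff]
  constructor
  · intro hl
    obtain ⟨l', rfl⟩ := exists_eq_concat_of_mem_chainSet hl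
    rcases mem_chainSet_concat.1 hl with ⟨rfl, -⟩ | h' | h'
    · rfl
    · rw [chainSet_eq_empty (by simp only; omega)] at h'
      exact h'.elim
    · rw [chainSet_eq_empty (by simp only; omega)] at h'
      exact h'.elim
  · rintro rfl
    simp [chainSet]

theorem chainSet_of_ne {a b : ℤ × ℤ} (h : a ≠ b) :
    chainSet a b =
      (fun l => l ++ [b]) '' (chainSet a (b.1 - 1, b.2) ∪ chainSet a (b.1, b.2 - 1)) := by
  ext l
  constructor
  · intro hl
    obtain ⟨l', rfl⟩ := exists_eq_concat_of_mem_chainSet hl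
    refine ⟨l', ?_, rfl⟩
    rcases mem_chainSet_concat.1 hl with ⟨-, h'⟩ | h' | h'
    · exact (h h').elim
    · exact Or.inl h'
    · exact Or.inr h'
  · rintro ⟨l', h', rfl⟩
    exact mem_chainSet_concat.2 (Or.inr h')

theorem chainSet_finite (a b : ℤ × ℤ) : (chainSet a b).Finite := by
  obtain ⟨n, hn⟩ : ∃ n : ℕ, b.1 + b.2 ≤ a.1 + a.2 + n := ⟨(b.1 + b.2 - a.1 - a.2).toNat, by omega⟩
  induction n generalizing b with
  | zero =>
    by_cases h : a = b
    · subst h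
      simp [chainSet_self]
    · rw [chainSet_eq_empty]
      · exact Set.finite_empty
      · rw [Prod.ext_iff] at h
        omega
  | succ n ih =>
    by_cases h : a = b
    · subst h
      simp [chainSet_self]
    · rw [chainSet_of_ne h]
      exact ((ih _ (by simp only; omega)).union (ih _ (by simp only; omega))).image _

theorem pathSum_eq_zero (x : ℤ × ℤ → ℝ) {a b : ℤ × ℤ} (h : ¬ (a.1 ≤ b.1 ∧ a.2 ≤ b.2)) :
    pathSum x a b = 0 := by
  simp [pathSum, chainSet_eq_empty h]

theorem pathSum_self (x : ℤ × ℤ → ℝ) (a : ℤ × ℤ) : pathSum x a a = x a := by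
  rw [pathSum, chainSet_self, finsum_mem_singleton]
  simp

theorem pathSum_of_ne (x : ℤ × ℤ → ℝ) {a b : ℤ × ℤ} (h : a ≠ b) :
    pathSum x a b = x b * (pathSum x a (b.1 - 1, b.2) + pathSum x a (b.1, b.2 - 1)) := by
  have hdisj : Disjoint (chainSet a (b.1 - 1, b.2)) (chainSet a (b.1, b.2 - 1)) := by
    rw [Set.disjoint_left]
    intro l h₁ h₂
    have := h₁.2.2.symm.trans h₂.2.2
    simp at this
  rw [pathSum, chainSet_of_ne h, finsum_mem_image (by intro l _ l' _ h; simpa using h),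
    finsum_mem_union hdisj (chainSet_finite _ _) (chainSet_finite _ _), pathSum, pathSum, mul_add,
    mul_finsum_mem, mul_finsum_mem]
  simp [mul_comm]

/-- The recursion for path sums, uniform in the end point. -/
theorem pathSum_mul_inv (x : ℤ × ℤ → ℝ) (a b : ℤ × ℤ) (h : x b ≠ 0) :
    pathSum x a b * (x b)⁻¹ =
      pathSum x a (b.1 - 1, b.2) + pathSum x a (b.1, b.2 - 1) + if a = b then 1 else 0 := by
  split_ifs with hab
  · subst hab
    rw [pathSum_self, pathSum_eq_zero _ (by simp only; omega),
      pathSum_eq_zero _ (by simp only; omega), mul_inv_cancel₀ h]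
    simp
  · rw [pathSum_of_ne x hab]
    field_simp
    ring

theorem phiInv_eq_pathSum (x : ℤ × ℤ → ℝ) (p : ℤ × ℤ) : phiInv x p = pathSum x (1, 1) p :=
  finsum_set_coe_eq_finsum_mem (f := fun l : List (ℤ × ℤ) => (l.map x).prod) (chainSet (1, 1) p)

theorem chain_mem_interval {a b : ℤ × ℤ} {l : List (ℤ × ℤ)} (h : l ∈ chainSet a b) {v : ℤ × ℤ}
    (hv : v ∈ l) : a.1 ≤ v.1 ∧ v.1 ≤ b.1 ∧ a.2 ≤ v.2 ∧ v.2 ≤ b.2 := by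
  induction l using List.reverseRecOn generalizing b with
  | nil => simp at hv
  | append_singleton l c ih =>
    obtain ⟨l', hl'⟩ := exists_eq_concat_of_mem_chainSet h
    obtain ⟨rfl, rfl⟩ : l = l' ∧ c = b := by simpa using hl'
    have hle : a.1 ≤ c.1 ∧ a.2 ≤ c.2 := by
      by_contra hle
      rw [chainSet_eq_empty hle] at h
      exact h
    rcases List.mem_append.1 hv with hv | hv
    · rcases mem_chainSet_concat.1 h with ⟨rfl, -⟩ | h' | h'
      · simp at hv
      · have := ih h' hv
        simp only at this
        omega
      · have := ih h' hv
        simp only at this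
        omega
    · rw [List.mem_singleton.1 hv]
      omega

/-- Single paths through an interval are the saturated chains between its corners. -/
def rsysOneEquiv (i₁ i₂ j₁ j₂ : ℤ) : RSys i₁ i₂ j₁ j₂ 1 ≃ chainSet (i₁, j₁) (i₂, j₂) where
  toFun L := ⟨L.path 0, L.chain 0, by simpa using L.first 0, by simpa using L.final 0⟩
  invFun l :=
    { path := fun _ => l.1
      chain := fun _ => l.2.1
      mem := fun _ _ hv => chain_mem_interval l.2 hv
      first := fun t => by simpa [Subsingleton.elim t 0] using l.2.2.1
      final := fun t => by simpa [Subsingleton.elim t 0] using l.2.2.2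
      disjoint := fun t t' h => (h (Subsingleton.elim t t')).elim }
  left_inv L := by
    obtain ⟨path, _, _, _, _, _⟩ := L
    have h : (fun _ => path 0) = path := funext fun t => by rw [Subsingleton.elim t 0]
    simp only [h]
  right_inv _ := rfl

theorem w_one_eq_pathSum (i₁ i₂ j₁ j₂ : ℤ) (x : ℤ × ℤ → ℝ) :
    w i₁ i₂ j₁ j₂ 1 x = pathSum x (i₁, j₁) (i₂, j₂) := by
  rw [w, if_neg (by norm_num), pathSum, ← finsum_set_coe_eq_finsum_mem]
  refine finsum_eq_of_bijective (rsysOneEquiv i₁ i₂ j₁ j₂) (Equiv.bijective _) fun L => ?_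
  simp only [RSysWeight, rsysOneEquiv, Equiv.coe_fn_mk]
  exact Fin.prod_univ_one _

theorem pathSum_pos {r s : ℕ} {x : ℤ × ℤ → ℝ} (hx : ∀ p, inR r s p → 0 < x p) {a b : ℤ × ℤ}
    (ha : inR r s a) (hb : inR r s b) (h₁ : a.1 ≤ b.1) (h₂ : a.2 ≤ b.2) : 0 < pathSum x a b := by
  obtain ⟨n, hn⟩ : ∃ n : ℕ, b.1 + b.2 ≤ a.1 + a.2 + n := ⟨(b.1 + b.2 - a.1 - a.2).toNat, by omega⟩
  unfold inR at ha hb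
  induction n generalizing b with
  | zero =>
    obtain rfl : a = b := Prod.ext (by omega) (by omega)
    rw [pathSum_self]
    exact hx a ha
  | succ n ih =>
    by_cases h : a = b
    · subst h
      rw [pathSum_self]
      exact hx a ha
    · rw [pathSum_of_ne x h]
      refine mul_pos (hx b hb) ?_
      have hl : a.1 < b.1 → 0 < pathSum x a (b.1 - 1, b.2) := fun hlt =>
        ih (by simp only; omega) (by simp only; omega) (by simp only; omega) (by simp only; omega)
      have hd : a.2 < b.2 → 0 < pathSum x a (b.1, b.2 - 1) := fun hlt =>
        ih (by simp only; omega) (by simp only; omega) (by simp only; omega) (by simp only; omega)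
      by_cases hl' : a.1 < b.1
      · by_cases hd' : a.2 < b.2
        · exact add_pos (hl hl') (hd hd')
        · rw [pathSum_eq_zero x (b := (b.1, b.2 - 1)) (by simp only; omega), add_zero]
          exact hl hl'
      · rw [pathSum_eq_zero x (b := (b.1 - 1, b.2)) (by simp only; omega), zero_add]
        refine hd ?_
        rw [Prod.ext_iff] at h
        omega

theorem dsum_congr {r s : ℕ} {y z : ℤ × ℤ → ℝ} {p : ℤ × ℤ}
    (h : ∀ q ∈ downSet r s p, y q = z q) : dsum r s y p = dsum r s z p := by
  rw [dsum, dsum, Finset.sum_congr rfl h]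

theorem usum_congr {r s : ℕ} {y z : ℤ × ℤ → ℝ} {p : ℤ × ℤ}
    (h : ∀ q ∈ upSet r s p, y q = z q) : usum r s y p = usum r s z p := by
  rw [usum, usum, Finset.sum_congr rfl fun q hq => congrArg (·⁻¹) (h q hq)]

theorem inR_of_mem_downSet {r s : ℕ} {p q : ℤ × ℤ} (h : q ∈ downSet r s p) : inR r s q :=
  (Finset.mem_filter.1 h).2

theorem inR_of_mem_upSet {r s : ℕ} {p q : ℤ × ℤ} (h : q ∈ upSet r s p) : inR r s q :=
  (Finset.mem_filter.1 h).2

theorem foldl_toggle_of_notMem {r s : ℕ} {l : List (ℤ × ℤ)} {q : ℤ × ℤ} (h : q ∉ l)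
    (y : ℤ × ℤ → ℝ) : l.foldl (fun y p => toggle r s p y) y q = y q := by
  induction l generalizing y with
  | nil => rfl
  | cons p l ih =>
    rw [List.mem_cons, not_or] at h
    rw [List.foldl_cons, ih h.2, toggle, if_neg h.1]

theorem foldl_toggle_congr {r s : ℕ} {l : List (ℤ × ℤ)} {y z : ℤ × ℤ → ℝ}
    (h : ∀ p, inR r s p → y p = z p) :
    ∀ p, inR r s p → l.foldl (fun y p => toggle r s p y) y p =
      l.foldl (fun y p => toggle r s p y) z p := by
  induction l generalizing y z with
  | nil => exact h
  | cons q l ih =>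
    refine ih fun p hp => ?_
    simp only [toggle]
    split_ifs with hpq
    · subst hpq
      rw [usum_congr fun q hq => h q (inR_of_mem_upSet hq),
        dsum_congr fun q hq => h q (inR_of_mem_downSet hq), h p hp]
    · exact h p hp

theorem rhoInv_iterate_congr {r s : ℕ} (k : ℕ) {y z : ℤ × ℤ → ℝ}
    (h : ∀ p, inR r s p → y p = z p) :
    ∀ p, inR r s p → (rhoInv r s)^[k] y p = (rhoInv r s)^[k] z p := by
  induction k generalizing y z with
  | zero => exact h
  | succ k ih => exact ih (foldl_toggle_congr h)

theorem rectList_eq (a b : ℕ) : rectList a b = (List.range a).reverse.flatMap fun i : ℕ =>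
    (List.range b).reverse.map fun j : ℕ => ((i : ℤ) + 1, (j : ℤ) + 1) := by
  simp only [rectList, List.bind_eq_flatMap, List.pure_def, List.flatMap_assoc, List.map_flatMap,
    List.flatMap_cons, List.flatMap_nil, List.append_nil, List.map_cons, List.map_nil]
  simp only [List.map_eq_flatMap]

theorem mem_rectList {r s : ℕ} {p : ℤ × ℤ} : p ∈ rectList r s ↔ inR r s p := by
  simp only [rectList_eq, List.mem_flatMap, List.mem_reverse, List.mem_range, List.mem_map, inR]
  constructor
  · rintro ⟨i, hi, j, hj, rfl⟩
    simp only
    omega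
  · intro h
    exact ⟨(p.1 - 1).toNat, by omega, (p.2 - 1).toNat, by omega,
      Prod.ext (by simp only; omega) (by simp only; omega)⟩

theorem rectList_reverse_pairwise (r s : ℕ) :
    (rectList r s).reverse.Pairwise fun p q => p.1 < q.1 ∨ p.1 = q.1 ∧ p.2 < q.2 := by
  simp only [rectList_eq, List.pairwise_reverse, List.pairwise_flatMap, List.pairwise_map,
    List.mem_map, List.mem_reverse, List.mem_range]
  refine ⟨fun i _ => ?_, ?_⟩
  · exact List.pairwise_lt_range.imp fun h => Or.inr ⟨trivial, by simpa using h⟩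
  · refine List.pairwise_lt_range.imp fun h => ?_
    rintro _ ⟨j, _, rfl⟩ _ ⟨j', _, rfl⟩
    exact Or.inl (by simpa using h)

/-- The defining recursion of inverse rowmotion. -/
theorem rhoInv_apply {r s : ℕ} (y : ℤ × ℤ → ℝ) {p : ℤ × ℤ} (hp : inR r s p) :
    rhoInv r s y p = usum r s y p * dsum r s (rhoInv r s y) p / y p := by
  have hpw := rectList_reverse_pairwise r s
  obtain ⟨l₁, l₂, hl⟩ := List.append_of_mem (List.mem_reverse.2 (mem_rectList.2 hp))
  have hfold (q : ℤ × ℤ) : rhoInv r s y q = l₂.foldl (fun y p => toggle r s p y)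
      (toggle r s p (l₁.foldl (fun y p => toggle r s p y) y)) q := by
    rw [rhoInv, hl, List.foldl_append, List.foldl_cons]
  rw [hl, List.pairwise_append, List.pairwise_cons] at hpw
  obtain ⟨-, ⟨hgt, -⟩, hlt⟩ := hpw
  have hlt' (q : ℤ × ℤ) (hq : q ∈ l₁) := hlt q hq p List.mem_cons_self
  have hp₁ : p ∉ l₁ := fun h => by have := hlt' p h; omega
  have hp₂ : p ∉ l₂ := fun h => by have := hgt p h; omega
  rw [hfold p, foldl_toggle_of_notMem hp₂, toggle, if_pos rfl, foldl_toggle_of_notMem hp₁]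
  congr 2
  · refine usum_congr fun q hq => foldl_toggle_of_notMem (fun h => ?_) y
    have := hlt' q h
    simp only [upSet, Finset.mem_filter, Finset.mem_insert, Finset.mem_singleton] at hq
    rcases hq with ⟨rfl | rfl, -⟩ <;> simp only at this <;> omega
  · refine dsum_congr fun q hq => ?_
    simp only [downSet, Finset.mem_filter, Finset.mem_insert, Finset.mem_singleton] at hq
    have hq₂ : q ∉ l₂ := fun h => by
      have := hgt q h
      rcases hq with ⟨rfl | rfl, -⟩ <;> simp only at this <;> omega
    have hqp : q ≠ p := by
      rintro rfl
      rcases hq with ⟨hq | hq, -⟩ <;> simp only [Prod.ext_iff] at hq <;> omega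
    rw [hfold q, foldl_toggle_of_notMem hq₂, toggle, if_neg hqp]

theorem dsum_eq_of_eq_zero {r s : ℕ} {y : ℤ × ℤ → ℝ} (hy : ∀ p : ℤ × ℤ, p.1 ≤ 0 ∨ p.2 ≤ 0 → y p = 0)
    {p : ℤ × ℤ} (hp : inR r s p) (hp₁ : p ≠ (1, 1)) :
    dsum r s y p = y (p.1 - 1, p.2) + y (p.1, p.2 - 1) := by
  obtain ⟨i, j⟩ := p
  simp only [inR] at hp
  have hne : ((i - 1, j) : ℤ × ℤ) ≠ (i, j - 1) := by simp
  simp only [ne_eq, Prod.mk.injEq] at hp₁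
  have hins : ({(i - 1, j), (i, j - 1)} : Finset (ℤ × ℤ)).filter (inR r s) = downSet r s (i, j) := rfl
  have hsum : ∑ q ∈ downSet r s (i, j), y q = y (i - 1, j) + y (i, j - 1) := by
    rw [← hins, Finset.sum_filter, Finset.sum_pair hne]
    congr 1
    · refine ite_eq_left_iff.2 fun h => (hy _ ?_).symm
      simp only [inR] at h
      simp only
      omega
    · refine ite_eq_left_iff.2 fun h => (hy _ ?_).symm
      simp only [inR] at h
      simp only
      omega
  rw [dsum, if_pos, hsum]
  by_cases hi : i = 1
  · exact ⟨(i, j - 1), by simp [downSet, inR]; omega⟩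
  · exact ⟨(i - 1, j), by simp [downSet, inR]; omega⟩

theorem phiInv_eq_zero (x : ℤ × ℤ → ℝ) (p : ℤ × ℤ) (hp : p.1 ≤ 0 ∨ p.2 ≤ 0) :
    phiInv x p = 0 := by
  rw [phiInv_eq_pathSum, pathSum_eq_zero]
  simp only
  omega

theorem phiInv_pos {r s : ℕ} {x : ℤ × ℤ → ℝ} (hx : ∀ p, inR r s p → 0 < x p) {p : ℤ × ℤ}
    (hp : inR r s p) : 0 < phiInv x p := by
  rw [phiInv_eq_pathSum]
  have hp' := hp
  unfold inR at hp'
  exact pathSum_pos hx (by simp only [inR]; omega) hp hp'.1 hp'.2.2.1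

theorem phiInv_eq_mul_dsum {r s : ℕ} (x : ℤ × ℤ → ℝ) {p : ℤ × ℤ} (hp : inR r s p) :
    phiInv x p = x p * dsum r s (phiInv x) p := by
  by_cases h : p = (1, 1)
  · subst h
    have hempty : downSet r s (1, 1) = ∅ := by
      refine Finset.filter_eq_empty_iff.2 fun q hq => ?_
      simp only [Finset.mem_insert, Finset.mem_singleton] at hq
      rcases hq with rfl | rfl <;> simp [inR]
    rw [phiInv_eq_pathSum, pathSum_self, dsum, hempty, if_neg Finset.not_nonempty_empty, mul_one]
  · rw [dsum_eq_of_eq_zero (phiInv_eq_zero x) hp h]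
    simp only [phiInv_eq_pathSum]
    exact pathSum_of_ne x (Ne.symm h)

/-- Inverse rowmotion carried over to the other side of the transfer map. -/
noncomputable def transferRhoInv (r s : ℕ) (x : ℤ × ℤ → ℝ) : ℤ × ℤ → ℝ :=
  fun p => usum r s (phiInv x) p / phiInv x p

theorem transferRhoInv_apply (r s : ℕ) (x : ℤ × ℤ → ℝ) (p : ℤ × ℤ) :
    transferRhoInv r s x p = usum r s (phiInv x) p / phiInv x p := rfl

theorem rhoInv_phiInv {r s : ℕ} (x : ℤ × ℤ → ℝ) (p : ℤ × ℤ) (hp : inR r s p) :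
    rhoInv r s (phiInv x) p = phiInv (transferRhoInv r s x) p := by
  obtain ⟨n, hn⟩ : ∃ n : ℕ, p.1 + p.2 ≤ n := ⟨(p.1 + p.2).toNat, by omega⟩
  induction n generalizing p with
  | zero =>
    unfold inR at hp
    omega
  | succ n ih =>
    rw [rhoInv_apply _ hp, phiInv_eq_mul_dsum (transferRhoInv r s x) hp,
      transferRhoInv_apply,
      dsum_congr (y := rhoInv r s (phiInv x)) (z := phiInv (transferRhoInv r s x)), mul_div_right_comm]
    intro q hq
    refine ih q (inR_of_mem_downSet hq) ?_
    simp only [downSet, Finset.mem_filter, Finset.mem_insert, Finset.mem_singleton] at hq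
    rcases hq with ⟨rfl | rfl, -⟩ <;> simp only <;> omega

theorem usum_pos {r s : ℕ} {y : ℤ × ℤ → ℝ} (hy : ∀ p, inR r s p → 0 < y p) (p : ℤ × ℤ) :
    0 < usum r s y p := by
  rw [usum]
  split_ifs with h
  · exact inv_pos.2 (Finset.sum_pos (fun q hq => inv_pos.2 (hy q (inR_of_mem_upSet hq))) h)
  · exact one_pos

theorem transferRhoInv_pos {r s : ℕ} {x : ℤ × ℤ → ℝ} (hx : ∀ p, inR r s p → 0 < x p) (p : ℤ × ℤ)
    (hp : inR r s p) : 0 < transferRhoInv r s x p :=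
  div_pos (usum_pos (fun _ hq => phiInv_pos hx hq) p) (phiInv_pos hx hp)

/-- The ratio of the values of `phiInv x` along the edge `(i - 1, j) ⋖ (i, j)` of the rectangle. -/
noncomputable def horRatio (r s : ℕ) (x : ℤ × ℤ → ℝ) (i j : ℤ) : ℝ :=
  if inR r s (i, j) ∧ inR r s (i - 1, j) then phiInv x (i - 1, j) / phiInv x (i, j) else 0

/-- The ratio of the values of `phiInv x` along the edge `(i, j - 1) ⋖ (i, j)` of the rectangle. -/
noncomputable def verRatio (r s : ℕ) (x : ℤ × ℤ → ℝ) (i j : ℤ) : ℝ :=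
  if inR r s (i, j) ∧ inR r s (i, j - 1) then phiInv x (i, j - 1) / phiInv x (i, j) else 0

/-- The inverse of a label, extended by zero outside the rectangle. -/
noncomputable def invLabel (r s : ℕ) (x : ℤ × ℤ → ℝ) (i j : ℤ) : ℝ :=
  if inR r s (i, j) then (x (i, j))⁻¹ else 0

theorem invLabel_eq {r s : ℕ} {x : ℤ × ℤ → ℝ} (hx : ∀ p, inR r s p → 0 < x p) {i j : ℤ}
    (hne : ¬ (i = 1 ∧ j = 1)) :
    invLabel r s x i j = horRatio r s x i j + verRatio r s x i j := by
  rw [invLabel, horRatio, verRatio]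
  by_cases hp : inR r s (i, j)
  · have hY := phiInv_pos hx hp
    have hX := hx _ hp
    have hrec := phiInv_eq_mul_dsum x hp
    rw [dsum_eq_of_eq_zero (phiInv_eq_zero x) hp (by simpa using hne)] at hrec
    have hh : (if inR r s (i, j) ∧ inR r s (i - 1, j) then phiInv x (i - 1, j) / phiInv x (i, j)
        else 0) = phiInv x (i - 1, j) / phiInv x (i, j) := by
      refine ite_eq_left_iff.2 fun h => ?_
      rw [phiInv_eq_zero, zero_div]
      simp only [inR] at h hp ⊢
      omega
    have hv : (if inR r s (i, j) ∧ inR r s (i, j - 1) then phiInv x (i, j - 1) / phiInv x (i, j)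
        else 0) = phiInv x (i, j - 1) / phiInv x (i, j) := by
      refine ite_eq_left_iff.2 fun h => ?_
      rw [phiInv_eq_zero, zero_div]
      simp only [inR] at h hp ⊢
      omega
    rw [if_pos hp, hh, hv, ← add_div, eq_div_iff hY.ne', inv_mul_eq_iff_eq_mul₀ hX.ne']
    exact hrec
  · simp [hp]

theorem invLabel_transferRhoInv {r s : ℕ} {x : ℤ × ℤ → ℝ} {i j : ℤ}
    (hne : ¬ (i = r ∧ j = s)) :
    invLabel r s (transferRhoInv r s x) i j =
      horRatio r s x (i + 1) j + verRatio r s x i (j + 1) := by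
  rw [invLabel, horRatio, verRatio, add_sub_cancel_right, add_sub_cancel_right]
  by_cases hp : inR r s (i, j)
  · have hne' : ((i + 1, j) : ℤ × ℤ) ≠ (i, j + 1) := by simp
    have hup : (upSet r s (i, j)).Nonempty := by
      simp only [inR] at hp
      by_cases hi : i = r
      · exact ⟨(i, j + 1), by simp [upSet, inR]; omega⟩
      · exact ⟨(i + 1, j), by simp [upSet, inR]; omega⟩
    rw [if_pos hp, transferRhoInv_apply, inv_div, usum, if_pos hup, div_inv_eq_mul, upSet,
      Finset.sum_filter, Finset.sum_pair hne', mul_add]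
    simp [hp, div_eq_mul_inv]
  · simp [hp]

theorem transferRhoInv_top {r s : ℕ} (x : ℤ × ℤ → ℝ) :
    (transferRhoInv r s x (r, s))⁻¹ = phiInv x (r, s) := by
  have hempty : upSet r s (r, s) = ∅ := by
    refine Finset.filter_eq_empty_iff.2 fun q hq => ?_
    simp only [Finset.mem_insert, Finset.mem_singleton] at hq
    rcases hq with rfl | rfl <;> simp [inR]
  rw [transferRhoInv_apply, usum, hempty, if_neg Finset.not_nonempty_empty, one_div, inv_inv]

theorem horRatio_mul_verRatio {r s : ℕ} {x : ℤ × ℤ → ℝ} (hx : ∀ p, inR r s p → 0 < x p) (i j : ℤ) :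
    horRatio r s x (i + 1) (j + 1) * verRatio r s x i (j + 1) =
      verRatio r s x (i + 1) (j + 1) * horRatio r s x (i + 1) j := by
  simp only [horRatio, verRatio, add_sub_cancel_right]
  by_cases h : inR r s (i, j) ∧ inR r s (i + 1, j + 1)
  · obtain ⟨h₁, h₂⟩ := h
    have h₃ : inR r s (i + 1, j) := by simp only [inR] at *; omega
    have h₄ : inR r s (i, j + 1) := by simp only [inR] at *; omega
    have := phiInv_pos hx h₃
    have := phiInv_pos hx h₄
    simp only [h₁, h₂, h₃, h₄, and_self, if_true]
    field_simp
  · rw [not_and_or] at h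
    rcases h with h | h <;> simp [h]

theorem verRatio_eq_zero {r s : ℕ} (x : ℤ × ℤ → ℝ) {i j : ℤ}
    (h : ¬ (1 ≤ i ∧ i ≤ r ∧ 2 ≤ j ∧ j ≤ s)) : verRatio r s x i j = 0 := by
  refine if_neg fun h' => h ?_
  simp only [inR] at h'
  omega

theorem pathSum_mul_invLabel {r s : ℕ} {x : ℤ × ℤ → ℝ} (hx : ∀ p, inR r s p → 0 < x p) {a b i j : ℤ}
    (hp : inR r s (i, j)) :
    pathSum x (a, b) (i, j) * invLabel r s x i j =
      pathSum x (a, b) (i - 1, j) + pathSum x (a, b) (i, j - 1) +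
        if a = i ∧ b = j then 1 else 0 := by
  rw [invLabel, if_pos hp, pathSum_mul_inv x (a, b) (i, j) (hx _ hp).ne']
  simp

theorem pathSum_transferRhoInv {r s : ℕ} {x : ℤ × ℤ → ℝ} (hx : ∀ p, inR r s p → 0 < x p) {a : ℤ}
    (ha : 1 ≤ a) {i j : ℤ} (hi : i + 1 ≤ r) (hj : j ≤ s) :
    pathSum (transferRhoInv r s x) (a, 1) (i, j) =
      pathSum x (a + 1, 1) (i + 1, j) -
        verRatio r s x (i + 1) (j + 1) * pathSum x (a + 1, 1) (i + 1, j + 1) := by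
  obtain ⟨n, hn⟩ : ∃ n : ℕ, i + j ≤ n := ⟨(i + j).toNat, by omega⟩
  induction n generalizing i j with
  | zero =>
    rw [pathSum_eq_zero _ (by simp only; omega), pathSum_eq_zero _ (by simp only; omega)]
    by_cases hj0 : j = 0
    · rw [verRatio_eq_zero _ (by omega)]
      simp
    · rw [pathSum_eq_zero _ (by simp only; omega)]
      simp
  | succ n ih =>
    by_cases hij : a ≤ i ∧ 1 ≤ j
    · have hp : inR r s (i, j) := by simp only [inR]; omega
      have hp' : inR r s (i + 1, j) := by simp only [inR]; omega
      have hA : invLabel r s (transferRhoInv r s x) i j ≠ 0 := by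
        rw [invLabel, if_pos hp]
        exact (inv_pos.2 (transferRhoInv_pos hx _ hp)).ne'
      have hrec := pathSum_mul_invLabel (a := a) (b := 1) (transferRhoInv_pos hx) hp
      have hrec₁ := pathSum_mul_invLabel (a := a + 1) (b := 1) hx hp'
      rw [ih (i := i - 1) (j := j) (by omega) hj (by push_cast at hn; omega),
        ih (i := i) (j := j - 1) hi (by omega) (by push_cast at hn; omega), sub_add_cancel, sub_add_cancel] at hrec
      rw [invLabel_eq hx (by omega), add_sub_cancel_right] at hrec₁
      simp only [add_left_inj] at hrec₁
      apply mul_right_cancel₀ hA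
      rw [hrec, invLabel_transferRhoInv (by omega)]
      by_cases hjs : j = s
      · rw [verRatio_eq_zero x (i := i + 1) (j := j + 1) (by omega),
          verRatio_eq_zero x (i := i) (j := j + 1) (by omega)]
        linear_combination -hrec₁
      · have hp'' : inR r s (i + 1, j + 1) := by simp only [inR]; omega
        have hrec₂ := pathSum_mul_invLabel (a := a + 1) (b := 1) hx hp''
        rw [invLabel_eq hx (by omega), if_neg (by omega), add_sub_cancel_right,
          add_sub_cancel_right] at hrec₂
        linear_combination -hrec₁ + verRatio r s x i (j + 1) * hrec₂ -
          pathSum x (a + 1, 1) (i + 1, j + 1) * horRatio_mul_verRatio hx i j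
    · rw [pathSum_eq_zero _ (by simp only; omega), pathSum_eq_zero _ (by simp only; omega)]
      by_cases hj0 : j = 0
      · rw [verRatio_eq_zero _ (by omega)]
        simp
      · rw [pathSum_eq_zero _ (by simp only; omega)]
        simp

theorem pathSum_transferRhoInv_right {r s : ℕ} {x : ℤ × ℤ → ℝ} (hx : ∀ p, inR r s p → 0 < x p)
    {a : ℤ} (ha : 1 ≤ a) {i : ℤ} (hi : i + 1 ≤ r) :
    pathSum (transferRhoInv r s x) (a, 1) (i, s) = pathSum x (a + 1, 1) (i + 1, s) := by
  rw [pathSum_transferRhoInv hx ha hi le_rfl, verRatio_eq_zero _ (by omega), zero_mul, sub_zero]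

theorem pathSum_column (x : ℤ × ℤ → ℝ) {a b : ℤ} (ha : 1 ≤ a) (hab : a + 1 ≤ b) :
    pathSum x (1, 1) (b, 1) = pathSum x (1, 1) (a, 1) * pathSum x (a + 1, 1) (b, 1) := by
  have hstep (c d : ℤ) (hcd : c < d) :
      pathSum x (c, 1) (d, 1) = x (d, 1) * pathSum x (c, 1) (d - 1, 1) := by
    rw [pathSum_of_ne x (by simp; omega), pathSum_eq_zero x (b := (_, (1 : ℤ) - 1)) (by simp),
      add_zero]
  induction b, hab using Int.leInduction with
  | base => rw [pathSum_self, hstep _ _ (by omega), add_sub_cancel_right, mul_comm]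
  | succ b hb ih =>
    rw [hstep 1 (b + 1) (by omega), hstep (a + 1) (b + 1) (by omega), add_sub_cancel_right, ih]
    ring

theorem pathSum_transferRhoInv_last_row {r s : ℕ} {x : ℤ × ℤ → ℝ}
    (hx : ∀ p, inR r s p → 0 < x p) {a : ℤ} (ha : 1 ≤ a) (har : a ≤ r) {j : ℤ} (hj : 1 ≤ j)
    (hjs : j ≤ s) :
    pathSum (transferRhoInv r s x) (a, 1) (r, j) * invLabel r s (transferRhoInv r s x) r j =
      (pathSum x (1, 1) (a, 1))⁻¹ * phiInv x (r, j) -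
        verRatio r s x r (j + 1) * pathSum x (a + 1, 1) (r, j + 1) := by
  have hc : 0 < pathSum x (1, 1) (a, 1) :=
    pathSum_pos hx (by simp only [inR]; omega) (by simp only [inR]; omega) ha le_rfl
  induction j, hj using Int.leInduction with
  | base =>
    rw [pathSum_mul_invLabel (transferRhoInv_pos hx) (by simp only [inR]; omega),
      pathSum_transferRhoInv hx ha (by omega) hjs, sub_add_cancel,
      pathSum_eq_zero _ (b := (_, (1 : ℤ) - 1)) (by simp), phiInv_eq_pathSum]
    by_cases h : a = r
    · rw [if_pos (by simpa using h), ← h, pathSum_eq_zero x (b := (a, 1)) (by simp),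
        inv_mul_cancel₀ hc.ne']
      ring
    · rw [if_neg (by simpa using h), pathSum_column x ha (b := r) (by omega),
        inv_mul_cancel_left₀ hc.ne']
      ring
  | succ j hj ih =>
    have hp : inR r s (r, j) := by simp only [inR]; omega
    have hp' : inR r s (r, j + 1) := by simp only [inR]; omega
    have hv : verRatio r s x r (j + 1) = phiInv x (r, j) / phiInv x (r, j + 1) := by
      rw [verRatio, add_sub_cancel_right, if_pos ⟨hp', hp⟩]
    have hu : horRatio r s x (r + 1) j = 0 := if_neg (by simp [inR])
    have hY := phiInv_pos hx hp
    have hY' := phiInv_pos hx hp'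
    have hprev : pathSum (transferRhoInv r s x) (a, 1) (r, j) =
        (pathSum x (1, 1) (a, 1))⁻¹ * phiInv x (r, j + 1) - pathSum x (a + 1, 1) (r, j + 1) := by
      have := ih (by omega)
      rw [invLabel_transferRhoInv (by omega), hu, zero_add] at this
      have hv0 : verRatio r s x r (j + 1) ≠ 0 := by rw [hv]; positivity
      apply mul_right_cancel₀ hv0
      rw [this, hv]
      field_simp
    rw [pathSum_mul_invLabel (transferRhoInv_pos hx) hp',
      pathSum_transferRhoInv hx ha (by omega) hjs, sub_add_cancel, add_sub_cancel_right, hprev,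
      if_neg (by omega)]
    ring

theorem pathSum_transferRhoInv_corner {r s : ℕ} (hs : 1 ≤ s) {x : ℤ × ℤ → ℝ}
    (hx : ∀ p, inR r s p → 0 < x p) {a : ℤ} (ha : 1 ≤ a) (har : a ≤ r) :
    pathSum (transferRhoInv r s x) (a, 1) (r, s) = (pathSum x (1, 1) (a, 1))⁻¹ := by
  have hp : inR r s (r, s) := by simp only [inR]; omega
  have h := pathSum_transferRhoInv_last_row hx ha har (j := s) (by omega) le_rfl
  rw [invLabel, if_pos hp, transferRhoInv_top, verRatio_eq_zero _ (by omega), zero_mul,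
    sub_zero] at h
  exact mul_right_cancel₀ (phiInv_pos hx hp).ne' h

/-- The index set of `omega r s x a b`, with all entries bounded by `m`. -/
def omegaSet (r s : ℕ) (a b m : ℤ) : Set (ℤ → ℤ) :=
  {g | ((∀ t, a ≤ t → t ≤ b → inR r s (g t, t - g t)) ∧
    (∀ t t', a ≤ t → t < t' → t' ≤ b → g t < g t') ∧
    (∀ t, t < a ∨ b < t → g t = 0)) ∧ ∀ t, a ≤ t → t ≤ b → g t ≤ m}

/-- The part of `omega r s x a b` with all first coordinates bounded by `m`. -/
noncomputable def omegaLE (r s : ℕ) (x : ℤ × ℤ → ℝ) (a b m : ℤ) : ℝ :=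
  ∑ᶠ g ∈ omegaSet r s a b m, (∏ t ∈ Finset.Icc a b, x (g t, t - g t))⁻¹

theorem omegaSet_eq_singleton (r s : ℕ) {a b : ℤ} (h : b < a) (m : ℤ) :
    omegaSet r s a b m = {0} := by
  ext g
  simp only [omegaSet, Set.mem_ofPred_eq, Set.mem_singleton_iff]
  constructor
  · rintro ⟨⟨-, -, h₀⟩, -⟩
    funext t
    exact h₀ t (by omega)
  · rintro rfl
    exact ⟨⟨fun t h₁ h₂ => by omega, fun t t' h₁ h₂ h₃ => by omega, fun _ _ => rfl⟩,
      fun t h₁ h₂ => by omega⟩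

theorem omegaSet_eq_empty (r s : ℕ) {a b m : ℤ} (h : a ≤ b) (hm : m ≤ 0) :
    omegaSet r s a b m = ∅ := by
  rw [Set.eq_empty_iff_forall_notMem]
  rintro g ⟨⟨hR, -, -⟩, hle⟩
  have h₁ := hR b h le_rfl
  have h₂ := hle b h le_rfl
  simp only [inR] at h₁
  omega

theorem omegaSet_eq_union (r s : ℕ) {a b : ℤ} (hab : a ≤ b) (m : ℤ) :
    omegaSet r s a b m = omegaSet r s a b (m - 1) ∪
      {g | inR r s (m, b - m) ∧
        g ∈ (fun g => Function.update g b m) '' omegaSet r s a (b - 1) (m - 1)} := by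
  ext g
  constructor
  · rintro ⟨⟨hR, hlt, h₀⟩, hle⟩
    rcases (hle b hab le_rfl).lt_or_eq with hb | hb
    · refine Or.inl ⟨⟨hR, hlt, h₀⟩, fun t h₁ h₂ => ?_⟩
      rcases h₂.lt_or_eq with h₂ | rfl
      · have := hlt t b h₁ h₂ le_rfl
        omega
      · omega
    · refine Or.inr ⟨hb ▸ hR b hab le_rfl, Function.update g b 0, ⟨⟨?_, ?_, ?_⟩, ?_⟩, ?_⟩
      · intro t h₁ h₂
        rw [Function.update_of_ne (by omega)]
        exact hR t h₁ (by omega)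
      · intro t t' h₁ h₂ h₃
        rw [Function.update_of_ne (by omega), Function.update_of_ne (by omega)]
        exact hlt t t' h₁ h₂ (by omega)
      · intro t h
        by_cases ht : t = b
        · rw [ht, Function.update_self]
        · rw [Function.update_of_ne ht]
          exact h₀ t (by omega)
      · intro t h₁ h₂
        rw [Function.update_of_ne (by omega)]
        have := hlt t b h₁ (by omega) le_rfl
        omega
      · simp [← hb]
  · rintro (⟨h, hle⟩ | ⟨hp, g, ⟨⟨hR, hlt, h₀⟩, hle⟩, rfl⟩)
    · refine ⟨h, fun t h₁ h₂ => ?_⟩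
      have := hle t h₁ h₂
      omega
    · refine ⟨⟨fun t h₁ h₂ => ?_, fun t t' h₁ h₂ h₃ => ?_, fun t h => ?_⟩, fun t h₁ h₂ => ?_⟩
      · by_cases ht : t = b
        · simpa [ht] using hp
        · simp only [Function.update_of_ne ht]
          exact hR t h₁ (by omega)
      · simp only [Function.update_of_ne (show t ≠ b by omega)]
        by_cases ht : t' = b
        · have := hle t h₁ (by omega)
          simp only [ht, Function.update_self]
          omega
        · simp only [Function.update_of_ne ht]
          exact hlt t t' h₁ h₂ (by omega)
      · simp only [Function.update_of_ne (show t ≠ b by omega)]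
        exact h₀ t (by omega)
      · by_cases ht : t = b
        · simp [ht]
        · simp only [Function.update_of_ne ht]
          have := hle t h₁ (by omega)
          omega

theorem omegaSet_finite (r s : ℕ) (a b m : ℤ) : (omegaSet r s a b m).Finite := by
  obtain ⟨n, hn⟩ : ∃ n : ℕ, b < a + n := ⟨(b + 1 - a).toNat, by omega⟩
  induction n generalizing b m with
  | zero =>
    rw [omegaSet_eq_singleton r s (by simpa using hn)]
    exact Set.finite_singleton 0
  | succ n ih =>
    by_cases hab : a ≤ b
    · obtain ⟨k, hk⟩ : ∃ k : ℕ, m ≤ k := ⟨m.toNat, by omega⟩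
      induction k generalizing m with
      | zero =>
        rw [omegaSet_eq_empty r s hab (by simpa using hk)]
        exact Set.finite_empty
      | succ k ihk =>
        rw [omegaSet_eq_union r s hab]
        exact (ihk _ (by push_cast at hk; omega)).union
          (((ih (b - 1) (m - 1) (by push_cast at hn; omega)).image _).subset fun _ h => h.2)
    · rw [omegaSet_eq_singleton r s (by omega)]
      exact Set.finite_singleton 0

theorem omegaLE_eq_one (r s : ℕ) (x : ℤ × ℤ → ℝ) {a b : ℤ} (h : b < a) (m : ℤ) :
    omegaLE r s x a b m = 1 := by
  rw [omegaLE, omegaSet_eq_singleton r s h, finsum_mem_singleton, Finset.Icc_eq_empty (by omega)]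
  simp

theorem omegaLE_eq_zero (r s : ℕ) (x : ℤ × ℤ → ℝ) {a b m : ℤ} (h : a ≤ b) (hm : m ≤ 0) :
    omegaLE r s x a b m = 0 := by
  rw [omegaLE, omegaSet_eq_empty r s h hm, finsum_mem_empty]

theorem omegaLE_recursion (r s : ℕ) (x : ℤ × ℤ → ℝ) {a b : ℤ} (hab : a ≤ b) (m : ℤ) :
    omegaLE r s x a b m = omegaLE r s x a b (m - 1) +
      invLabel r s x m (b - m) * omegaLE r s x a (b - 1) (m - 1) := by
  by_cases hp : inR r s (m, b - m)
  · have hset : {g | inR r s (m, b - m) ∧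
        g ∈ (fun g => Function.update g b m) '' omegaSet r s a (b - 1) (m - 1)} =
        (fun g => Function.update g b m) '' omegaSet r s a (b - 1) (m - 1) := by
      ext g
      simp [hp]
    have hdisj : Disjoint (omegaSet r s a b (m - 1))
        ((fun g => Function.update g b m) '' omegaSet r s a (b - 1) (m - 1)) := by
      rw [Set.disjoint_left]
      rintro _ ⟨-, hle⟩ ⟨g, -, rfl⟩
      have := hle b hab le_rfl
      simp only [Function.update_self] at this
      omega
    have hinj : (omegaSet r s a (b - 1) (m - 1)).InjOn fun g => Function.update g b m := by
      intro g hg g' hg' h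
      funext t
      by_cases ht : t = b
      · rw [hg.1.2.2 t (by omega), hg'.1.2.2 t (by omega)]
      · simpa [Function.update_of_ne ht] using congrFun h t
    have hIcc : Finset.Icc a b = insert b (Finset.Icc a (b - 1)) := by
      ext t
      simp only [Finset.mem_Icc, Finset.mem_insert]
      omega
    rw [omegaLE, omegaSet_eq_union r s hab, hset,
      finsum_mem_union hdisj (omegaSet_finite ..) ((omegaSet_finite ..).image _),
      finsum_mem_image hinj, ← omegaLE, omegaLE, omegaLE, mul_finsum_mem, invLabel, if_pos hp]
    congr 1
    refine finsum_mem_congr rfl fun g _ => ?_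
    rw [hIcc, Finset.prod_insert (by simp), mul_inv, Function.update_self]
    congr 2
    refine Finset.prod_congr rfl fun t ht => ?_
    rw [Finset.mem_Icc] at ht
    rw [Function.update_of_ne (by omega)]
  · have hset : {g | inR r s (m, b - m) ∧
        g ∈ (fun g => Function.update g b m) '' omegaSet r s a (b - 1) (m - 1)} = ∅ := by
      ext g
      simp [hp]
    rw [omegaLE, omegaSet_eq_union r s hab, hset, Set.union_empty, ← omegaLE, invLabel, if_neg hp,
      zero_mul, add_zero]

theorem omegaLE_eq_omega (r s : ℕ) (x : ℤ × ℤ → ℝ) (a b : ℤ) {m : ℤ} (hm : r ≤ m) :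
    omegaLE r s x a b m = omega r s x a b := by
  have hset : omegaSet r s a b m = {g | ((∀ t, a ≤ t → t ≤ b → inR r s (g t, t - g t)) ∧
      (∀ t t', a ≤ t → t < t' → t' ≤ b → g t < g t') ∧
      (∀ t, t < a ∨ b < t → g t = 0))} := by
    ext g
    refine ⟨fun h => h.1, fun h => ⟨h, fun t h₁ h₂ => ?_⟩⟩
    have := h.1 t h₁ h₂
    simp only [inR] at this
    omega
  rw [omegaLE, hset, ← finsum_set_coe_eq_finsum_mem]
  rfl

theorem omegaLE_transferRhoInv {r s : ℕ} {x : ℤ × ℤ → ℝ} (hx : ∀ p, inR r s p → 0 < x p) {a : ℤ}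
    (ha : 2 ≤ a) (n : ℕ) (hn : a + n ≤ r + s) (m : ℤ) :
    omegaLE r s x (a + 1) (a + n) m =
      omegaLE r s (transferRhoInv r s x) a (a + n - 1) (m - 1) +
        verRatio r s x m (a + n - m) *
          if n = 0 then 0 else omegaLE r s (transferRhoInv r s x) a (a + n - 2) (m - 1) := by
  induction n generalizing m with
  | zero =>
    rw [omegaLE_eq_one _ _ _ (by simp), omegaLE_eq_one _ _ _ (by simp)]
    simp
  | succ n ih =>
    push_cast at hn ⊢
    rw [show a + (n + 1 : ℤ) - 1 = a + n by ring, show a + (n + 1 : ℤ) - 2 = a + n - 1 by ring]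
    by_cases hm : m ≤ 0
    · rw [omegaLE_eq_zero _ _ _ (by omega) hm, omegaLE_eq_zero _ _ _ (by omega) (by omega),
        verRatio_eq_zero _ (by omega)]
      ring
    · obtain ⟨k, rfl⟩ : ∃ k : ℕ, m = k := ⟨m.toNat, by omega⟩
      clear hm
      induction k with
      | zero =>
        rw [omegaLE_eq_zero _ _ _ (by omega) (by simp), omegaLE_eq_zero _ _ _ (by omega) (by simp),
          verRatio_eq_zero _ (by simp)]
        ring
      | succ k ihk =>
        push_cast
        have hG := omegaLE_recursion r s x (a := a + 1) (b := a + (n + 1)) (by omega) (k + 1)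
        have hF := omegaLE_recursion r s (transferRhoInv r s x) (a := a) (b := a + n) (by omega) k
        have hF' : omegaLE r s (transferRhoInv r s x) a (a + n - 1) k =
            omegaLE r s (transferRhoInv r s x) a (a + n - 1) (k - 1) +
              invLabel r s (transferRhoInv r s x) k (a + n - 1 - k) *
              if n = 0 then 0 else omegaLE r s (transferRhoInv r s x) a (a + n - 2) (k - 1) := by
          split_ifs with h0
          · rw [omegaLE_eq_one _ _ _ (by omega), omegaLE_eq_one _ _ _ (by omega)]
            ring
          · rw [omegaLE_recursion r s (transferRhoInv r s x) (by omega) k,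
              show a + (n : ℤ) - 1 - 1 = a + n - 2 by ring]
        rw [add_sub_cancel_right, show a + ((n : ℤ) + 1) - 1 = a + n by ring, ihk, ih (by omega),
          show a + ((n : ℤ) + 1) - (k + 1) = a + n - k by ring, invLabel_eq hx (by omega)] at hG
        rw [invLabel_transferRhoInv (by omega)] at hF hF'
        have hsq := horRatio_mul_verRatio hx (k : ℤ) (a + n - 1 - k)
        rw [show a + (n : ℤ) - 1 - k + 1 = a + n - k by ring] at hF' hsq
        rw [show a + ((n : ℤ) + 1) - k = a + n - k + 1 by ring] at hG
        rw [add_sub_cancel_right, show a + ((n : ℤ) + 1) - (k + 1) = a + n - k by ring, hG, hF, hF']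
        linear_combination
          (if n = 0 then 0 else omegaLE r s (transferRhoInv r s x) a (a + n - 2) (k - 1)) * hsq

theorem omega_transferRhoInv {r s : ℕ} {x : ℤ × ℤ → ℝ} (hx : ∀ p, inR r s p → 0 < x p) {a b : ℤ}
    (ha : 2 ≤ a) (hab : a ≤ b + 1) (hb : b + 1 ≤ r + s) :
    omega r s (transferRhoInv r s x) a b = omega r s x (a + 1) (b + 1) := by
  obtain ⟨n, hn⟩ : ∃ n : ℕ, b + 1 = a + n := ⟨(b + 1 - a).toNat, by omega⟩
  have h := omegaLE_transferRhoInv hx ha n (by omega) (r + 1)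
  rw [← hn, verRatio_eq_zero _ (by omega), zero_mul, add_zero, add_sub_cancel_right,
    add_sub_cancel_right, omegaLE_eq_omega _ _ _ _ _ (by omega),
    omegaLE_eq_omega _ _ _ _ _ le_rfl] at h
  exact h.symm

theorem omega_two {r s : ℕ} (hs : 1 ≤ s) (x : ℤ × ℤ → ℝ) {a : ℤ} (ha : 1 ≤ a) (har : a ≤ r) :
    omega r s x 2 (a + 1) = (pathSum x (1, 1) (a, 1))⁻¹ := by
  have hprod : ∏ t ∈ Finset.Icc 2 (a + 1), x (t - 1, 1) = pathSum x (1, 1) (a, 1) := by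
    clear har
    induction a, ha using Int.leInduction with
    | base => simp [pathSum_self]
    | succ a ha ih =>
      have hIcc : Finset.Icc 2 (a + 1 + 1) = insert (a + 1 + 1) (Finset.Icc 2 (a + 1)) := by
        ext t
        simp only [Finset.mem_Icc, Finset.mem_insert]
        omega
      rw [hIcc, Finset.prod_insert (by simp), ih, pathSum_column x ha le_rfl, pathSum_self,
        add_sub_cancel_right, mul_comm]
  have hmem : ∀ g : OmegaIdx r s 2 (a + 1), ∀ t, 2 ≤ t → t ≤ a + 1 → g.1 t = t - 1 := by
    intro g t ht
    have hle : t ≤ a + 1 → t - 1 ≤ g.1 t := by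
      induction t, ht using Int.leInduction with
      | base =>
        intro h
        have := (g.2.1 2 le_rfl h).1
        simp only at this
        omega
      | succ t ht ih =>
        intro h
        have := ih (by omega)
        have := g.2.2.1 t (t + 1) ht (by omega) h
        omega
    intro h
    have h₁ := hle h
    have h₂ := (g.2.1 t ht h).2.2.1
    simp only at h₂
    omega
  let g₀ : OmegaIdx r s 2 (a + 1) := ⟨fun t => if 2 ≤ t ∧ t ≤ a + 1 then t - 1 else 0,
    fun t h₁ h₂ => by beta_reduce; rw [if_pos ⟨h₁, h₂⟩]; simp only [inR]; omega,
    fun t t' h₁ h₂ h₃ => by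
      beta_reduce; rw [if_pos (by omega), if_pos (by omega)]; omega,
    fun t h => if_neg (by omega)⟩
  have huniq : ∀ g : OmegaIdx r s 2 (a + 1), g = g₀ := fun g => by
    refine Subtype.ext (funext fun t => ?_)
    by_cases h : 2 ≤ t ∧ t ≤ a + 1
    · rw [hmem g t h.1 h.2, hmem g₀ t h.1 h.2]
    · rw [g.2.2.2 t (by omega), g₀.2.2.2 t (by omega)]
  rw [omega, finsum_eq_single _ g₀ fun g hg => (hg (huniq g)).elim, ← hprod]
  congr 1
  refine Finset.prod_congr rfl fun t ht => ?_
  rw [Finset.mem_Icc] at ht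
  rw [hmem g₀ t ht.1 ht.2, sub_sub_cancel]

theorem rhoInv_iterate_succ_phiInv {r s : ℕ} (k : ℕ) (x : ℤ × ℤ → ℝ) {p : ℤ × ℤ}
    (hp : inR r s p) :
    (rhoInv r s)^[k + 1] (phiInv x) p = (rhoInv r s)^[k] (phiInv (transferRhoInv r s x)) p :=
  rhoInv_iterate_congr k (rhoInv_phiInv x) p hp

theorem rhoInv_iterate_eq_pathSum {r s : ℕ} (hs : 1 ≤ s) (k : ℕ) {x : ℤ × ℤ → ℝ}
    (hx : ∀ p, inR r s p → 0 < x p) {i : ℤ} (hi1 : 1 ≤ i) (hik : i + k ≤ r) :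
    (rhoInv r s)^[k] (phiInv x) (i, (s : ℤ)) = pathSum x (k + 1, 1) (k + i, s) := by
  induction k generalizing x with
  | zero => simp [phiInv_eq_pathSum]
  | succ k ih =>
    push_cast at hik
    rw [rhoInv_iterate_succ_phiInv k x (by simp only [inR]; omega),
      ih (transferRhoInv_pos hx) (by omega), pathSum_transferRhoInv_right hx (by omega) (by omega)]
    push_cast
    rw [add_right_comm (k : ℤ) i 1]

theorem rhoInv_iterate_eq_omega {r s : ℕ} (hs : 1 ≤ s) (k : ℕ) {x : ℤ × ℤ → ℝ}
    (hx : ∀ p, inR r s p → 0 < x p) {i : ℤ} (hi1 : 1 ≤ i) (hir : i ≤ r) (hk : k + 1 ≤ r + s)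
    (hik : r < i + k) :
    (rhoInv r s)^[k] (phiInv x) (i, (s : ℤ)) = omega r s x (k + i - r + 1) (k + 1) := by
  induction k generalizing x with
  | zero => simp at hik; omega
  | succ k ih =>
    push_cast at hik ⊢
    rw [rhoInv_iterate_succ_phiInv k x (by simp only [inR]; omega)]
    rcases (show (r : ℤ) ≤ i + k by omega).lt_or_eq with h | h
    · rw [ih (transferRhoInv_pos hx) (by omega) h, omega_transferRhoInv hx (by omega) (by omega)
        (by omega)]
      congr 1
      ring
    · rw [rhoInv_iterate_eq_pathSum hs k (transferRhoInv_pos hx) hi1 h.ge,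
        show (k : ℤ) + i = r by omega, pathSum_transferRhoInv_corner (a := (k : ℤ) + 1) hs hx (by omega) (by omega),
        ← omega_two (r := r) (a := (k : ℤ) + 1) hs x (by omega) (by omega)]
      congr 1
      omega

/-- **Proposition 4.3.** The entries of the generalized Stanley–Thomas word `ST_i(x)`:
`ρ^{-k}(y)_{is} = w^{(1)}_{[k+1,k+i] × [1,s]}(x)` for `0 ≤ k ≤ r - i`, and
`ρ^{-k}(y)_{is} = ω_{k+i-r+1, k+1}(x)` for `r - i < k ≤ r + s - 1`, where `y = φ⁻¹(x)`. -/
theorem stanley_thomas_entries (r s : ℕ) (hr : 1 ≤ r) (hs : 1 ≤ s) (x : ℤ × ℤ → ℝ)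
    (hx : ∀ p, inR r s p → 0 < x p) (i : ℤ) (hi1 : 1 ≤ i) (hir : i ≤ (r : ℤ))
    (k : ℕ) (hk : k ≤ r + s - 1) :
    ((k : ℤ) ≤ (r : ℤ) - i →
      (rhoInv r s)^[k] (phiInv x) (i, (s : ℤ)) = w ((k : ℤ) + 1) ((k : ℤ) + i) 1 s 1 x) ∧
    ((r : ℤ) - i < (k : ℤ) →
      (rhoInv r s)^[k] (phiInv x) (i, (s : ℤ))
        = omega r s x ((k : ℤ) + i - r + 1) ((k : ℤ) + 1)) := by
  refine ⟨fun h => ?_, fun h => ?_⟩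
  · rw [w_one_eq_pathSum]
    exact rhoInv_iterate_eq_pathSum hs k hx hi1 (by omega)
  · exact rhoInv_iterate_eq_omega hs k hx hi1 hir (by omega) (by omega)

end Paper
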